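/- Let Γ be an n-vertex connected nonregular finite simple graph whose adjacency matrix has exactly three distinct eigenvalues s > 1 > −t. Then δ(Γ) < s < Δ(Γ), and n ≤ s² + 1 with equality if and only if Γ is the star K_{1,n−1}. -/

import Mathlib

section

open Matrix

/-- A real symmetric matrix whose spectrum is bounded below by `m` has quadratic form at least
`m` times the squared norm. -/
theorem Matrix.IsHermitian.posSemidef_sub_smul_one {V : Type*} [Fintype V] [DecidableEq V]
    {A : Matrix V V ℝ} (hA : A.IsHermitian) {m : ℝ} (h : ∀ x ∈ spectrum ℝ A, m ≤ x) :
    (A - m • 1).PosSemidef := by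
  have hB : (A - m • (1 : Matrix V V ℝ)).IsHermitian :=
    hA.sub (by simp [Matrix.IsHermitian])
  rw [hB.posSemidef_iff_eigenvalues_nonneg]
  intro i
  have h1 := hB.eigenvalues_mem_spectrum_real i
  generalize hB.eigenvalues i = l at h1
  rw [← Algebra.algebraMap_eq_smul_one, ← spectrum.sub_singleton_eq] at h1
  obtain ⟨y, hy, z, hzm, hz⟩ := h1
  have := h y hy
  have hz' : y - z = l := hz
  have hzm' : z = m := hzm
  simp only [Pi.zero_apply]
  linarith

/-- A real symmetric matrix with spectrum bounded above by `m` has quadratic form at most `m` times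
the squared norm. -/
theorem Matrix.IsHermitian.posSemidef_smul_one_sub {V : Type*} [Fintype V] [DecidableEq V]
    {A : Matrix V V ℝ} (hA : A.IsHermitian) {m : ℝ} (h : ∀ x ∈ spectrum ℝ A, x ≤ m) :
    (m • 1 - A).PosSemidef := by
  have := hA.neg.posSemidef_sub_smul_one (m := -m) (fun x hx => by
    rw [← spectrum.neg_eq] at hx
    linarith [h _ hx])
  rwa [neg_smul, sub_neg_eq_add, neg_add_eq_sub] at this

/-- A real symmetric matrix with spectrum in `{a, b, c}` is annihilated by
`(X - a) (X - b) (X - c)`. -/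
theorem Matrix.IsHermitian.mul_mul_eq_zero_of_spectrum_subset {V : Type*} [Fintype V]
    [DecidableEq V] {A : Matrix V V ℝ} (hA : A.IsHermitian) {a b c : ℝ}
    (h : spectrum ℝ A ⊆ {a, b, c}) :
    (A - a • 1) * ((A - b • 1) * (A - c • 1)) = 0 := by
  set B := (A - a • 1) * ((A - b • 1) * (A - c • 1)) with hB
  have key : ∀ (j : V) , B *ᵥ ⇑(hA.eigenvectorBasis j) = 0 := by
    intro j
    have h1 := hA.mulVec_eigenvectorBasis j
    have h2 : hA.eigenvalues j ∈ ({a, b, c} : Set ℝ) := h (hA.eigenvalues_mem_spectrum_real j)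
    have h3 : ∀ m : ℝ, (A - m • (1 : Matrix V V ℝ)) *ᵥ ⇑(hA.eigenvectorBasis j) =
        (hA.eigenvalues j - m) • ⇑(hA.eigenvectorBasis j) := by
      intro m
      rw [sub_mulVec, h1, smul_mulVec, one_mulVec, sub_smul]
    rw [hB, ← mulVec_mulVec, ← mulVec_mulVec, h3, mulVec_smul, h3, smul_smul, mulVec_smul, h3,
      smul_smul]
    have : (hA.eigenvalues j - c) * (hA.eigenvalues j - b) * (hA.eigenvalues j - a) = 0 := by
      rcases h2 with h2 | h2 | (h2 : _ = c) <;> simp [h2]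
    rw [this, zero_smul]
  have : toEuclideanLin B = 0 := hA.eigenvectorBasis.toBasis.ext fun j => by
    ext i
    simpa [toLpLin_apply] using congrFun (key j) i
  simpa using this

namespace SimpleGraph

variable {V : Type*} [Fintype V] (Γ : SimpleGraph V) [DecidableRel Γ.Adj]

/-- A nonnegative eigenvector of a connected graph with a zero entry vanishes. -/
theorem Connected.eq_zero_of_adjMatrix_mulVec_eq_smul {Γ : SimpleGraph V} [DecidableRel Γ.Adj]
    (hconn : Γ.Connected) {s : ℝ} {x : V → ℝ} (hx : Γ.adjMatrix ℝ *ᵥ x = s • x)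
    (hx0 : ∀ i, 0 ≤ x i) {i : V} (hi : x i = 0) : x = 0 := by
  have step : ∀ u v, Γ.Adj u v → x u = 0 → x v = 0 := by
    intro u v huv hu
    have h := congrFun hx u
    rw [adjMatrix_mulVec_apply, Pi.smul_apply, hu, smul_zero,
      Finset.sum_eq_zero_iff_of_nonneg fun j _ => hx0 j] at h
    exact h v (by simpa using huv)
  ext j
  obtain ⟨w⟩ := hconn.preconnected i j
  induction w with
  | nil => exact hi
  | cons h _ ih => exact ih (step _ _ h hi)

/-- If `s` bounds the spectrum, then the absolute value of an `s`-eigenvector is again an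
`s`-eigenvector. -/
theorem adjMatrix_mulVec_abs_eq_smul [DecidableEq V] {s : ℝ}
    (hs : (s • 1 - Γ.adjMatrix ℝ).PosSemidef) {x : V → ℝ}
    (hx : Γ.adjMatrix ℝ *ᵥ x = s • x) :
    Γ.adjMatrix ℝ *ᵥ (fun i => |x i|) = s • fun i => |x i| := by
  set y : V → ℝ := fun i => |x i| with hy
  have hquad : ∀ y : V → ℝ, star y ⬝ᵥ ((s • 1 - Γ.adjMatrix ℝ) *ᵥ y) =
      s * ∑ i, y i ^ 2 - ∑ i, ∑ j, Γ.adjMatrix ℝ i j * (y i * y j) := by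
    intro y
    rw [sub_mulVec, smul_mulVec, one_mulVec, dotProduct_sub]
    simp only [dotProduct, star_trivial, Pi.smul_apply, smul_eq_mul, mulVec, Finset.mul_sum]
    congr 1
    · exact Finset.sum_congr rfl fun i _ => by ring
    · exact Finset.sum_congr rfl fun i _ => Finset.sum_congr rfl fun j _ => by ring
  have h0 : star x ⬝ᵥ ((s • 1 - Γ.adjMatrix ℝ) *ᵥ x) = 0 := by
    simp [sub_mulVec, smul_mulVec, hx]
  have h1 : star y ⬝ᵥ ((s • 1 - Γ.adjMatrix ℝ) *ᵥ y) = 0 := by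
    refine le_antisymm ?_ (hs.dotProduct_mulVec_nonneg _)
    rw [← h0, hquad, hquad]
    simp only [hy, sq_abs]
    refine sub_le_sub_left (Finset.sum_le_sum fun i _ => Finset.sum_le_sum fun j _ => ?_) _
    refine mul_le_mul_of_nonneg_left ?_ ?_
    · rw [← abs_mul]; exact le_abs_self _
    · rw [adjMatrix_apply]; split_ifs <;> norm_num
  rw [hs.dotProduct_mulVec_zero_iff, sub_mulVec, smul_mulVec, one_mulVec, sub_eq_zero] at h1
  exact h1.symm

/-- Perron–Frobenius: the eigenspace of a connected graph for an upper bound `s` of the spectrum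
is spanned by any of its vectors without zero entries. -/
theorem Connected.eq_smul_of_adjMatrix_mulVec_eq_smul [DecidableEq V] {Γ : SimpleGraph V}
    [DecidableRel Γ.Adj] (hconn : Γ.Connected) {s : ℝ}
    (hs : (s • 1 - Γ.adjMatrix ℝ).PosSemidef) {a x : V → ℝ}
    (ha : Γ.adjMatrix ℝ *ᵥ a = s • a) (hx : Γ.adjMatrix ℝ *ᵥ x = s • x) {i : V} (hi : a i ≠ 0) :
    x = (x i / a i) • a := by
  have h : Γ.adjMatrix ℝ *ᵥ (x - (x i / a i) • a) = s • (x - (x i / a i) • a) := by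
    rw [mulVec_sub, mulVec_smul, ha, hx, smul_sub, smul_comm]
  have h2 := hconn.eq_zero_of_adjMatrix_mulVec_eq_smul (adjMatrix_mulVec_abs_eq_smul Γ hs h)
    (fun j => abs_nonneg _) (i := i) (by simp [hi])
  exact sub_eq_zero.mp (funext fun j => abs_eq_zero.mp (congrFun h2 j))

/-- The adjacency matrix of a connected graph with three eigenvalues `s > 1 > -t` satisfies
`A² = (1 - t) A + t I + β βᵀ` for a positive `s`-eigenvector `β`. -/
theorem Connected.exists_sq_adjMatrix_eq [DecidableEq V] {Γ : SimpleGraph V}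
    [DecidableRel Γ.Adj] (hconn : Γ.Connected) {s t : ℝ} (hs : 1 < s) (ht : -t < 1)
    (hspec : spectrum ℝ (Γ.adjMatrix ℝ) = {s, 1, -t}) :
    ∃ β : V → ℝ, (∀ i, 0 < β i) ∧ Γ.adjMatrix ℝ *ᵥ β = s • β ∧
      ∀ i j, (Γ.adjMatrix ℝ * Γ.adjMatrix ℝ) i j =
        (1 - t) * Γ.adjMatrix ℝ i j + t * (1 : Matrix V V ℝ) i j + β i * β j := by
  set A := Γ.adjMatrix ℝ with hA
  have hsym : A.IsSymm := isSymm_adjMatrix ..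
  have hH : A.IsHermitian := by
    rw [Matrix.IsHermitian, conjTranspose_eq_transpose_of_trivial]; exact hsym
  have hps : (s • 1 - A).PosSemidef := hH.posSemidef_smul_one_sub (by
    rw [hspec]; rintro x (rfl | rfl | (rfl : x = -t)) <;> linarith)
  have hzero := hH.mul_mul_eq_zero_of_spectrum_subset hspec.subset
  set M := (A - (1 : ℝ) • 1) * (A - (-t) • 1) with hM
  have hMe : M = A * A - (1 - t) • A - t • 1 := by
    rw [hM]
    rw [sub_mul, mul_sub, mul_sub, mul_smul_comm, mul_one, smul_mul_assoc, smul_mul_assoc,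
      one_mul, one_mul]
    module
  have hMs : M.IsSymm := by
    rw [hMe, Matrix.IsSymm]
    simp [transpose_sub, transpose_smul, transpose_mul, hsym.eq]
  have hAM : A * M = s • M := by
    rw [sub_mul, smul_mul_assoc, one_mul, sub_eq_zero] at hzero
    exact hzero
  obtain ⟨a, hapos, ha⟩ : ∃ a : V → ℝ, (∀ i, 0 < a i) ∧ A *ᵥ a = s • a := by
    have hmem : s ∈ spectrum ℝ A := by rw [hspec]; simp
    rw [← Matrix.spectrum_toLin', ← Module.End.hasEigenvalue_iff_mem_spectrum] at hmem
    obtain ⟨x, hx⟩ := hmem.exists_hasEigenvector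
    have hxs : A *ᵥ x = s • x := by simpa using hx.apply_eq_smul
    have habs := adjMatrix_mulVec_abs_eq_smul Γ hps hxs
    refine ⟨fun i => |x i|, fun i => lt_of_le_of_ne (abs_nonneg _) fun h => hx.2 ?_, habs⟩
    have h0 := hconn.eq_zero_of_adjMatrix_mulVec_eq_smul habs (fun j => abs_nonneg _) h.symm
    exact funext fun j => abs_eq_zero.mp (congrFun h0 j)
  obtain ⟨v⟩ := hconn.nonempty
  have hcol : ∀ i j, M i j = M v j / a v * a i := by
    intro i j
    have h : A *ᵥ (fun i => M i j) = s • fun i => M i j := by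
      ext i
      simpa [mulVec, dotProduct, Matrix.mul_apply] using congrFun (congrFun hAM i) j
    exact congrFun (hconn.eq_smul_of_adjMatrix_mulVec_eq_smul hps ha h (hapos v).ne') i
  set k := M v v / (a v * a v) with hk
  have hMk : ∀ i j, M i j = k * (a i * a j) := by
    intro i j
    have hv := (hapos v).ne'
    have h1 : M v j = M v v / a v * a j := by rw [← hMs.apply v j]; exact hcol j v
    rw [hcol, h1, hk]
    field_simp
  have hMa : M *ᵥ a = ((s - 1) * (s + t)) • a := by
    have h : ∀ m : ℝ, (A - m • (1 : Matrix V V ℝ)) *ᵥ a = (s - m) • a := fun m => by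
      rw [sub_mulVec, ha, smul_mulVec, one_mulVec, sub_smul]
    rw [hM, ← mulVec_mulVec, h, mulVec_smul, h, smul_smul]
    ring_nf
  have hkpos : 0 < k := by
    have h := congrFun hMa v
    simp only [mulVec, dotProduct, hMk, Pi.smul_apply, smul_eq_mul] at h
    have h2 : k * (a v * ∑ j, a j * a j) = (s - 1) * (s + t) * a v := by
      rw [← h, Finset.mul_sum, Finset.mul_sum]
      exact Finset.sum_congr rfl fun j _ => by ring
    refine pos_of_mul_pos_left (b := a v * ∑ j, a j * a j) ?_ ?_
    · rw [h2]
      exact mul_pos (mul_pos (by linarith) (by linarith)) (hapos v)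
    · exact mul_nonneg (hapos v).le (Finset.sum_nonneg fun j _ => mul_self_nonneg _)
  refine ⟨√k • a, fun i => mul_pos (Real.sqrt_pos.mpr hkpos) (hapos i), ?_, fun i j => ?_⟩
  · rw [mulVec_smul, ha, smul_comm]
  · have h := hMk i j
    rw [hMe] at h
    simp only [Matrix.sub_apply, Matrix.smul_apply, smul_eq_mul] at h
    simp only [Pi.smul_apply, smul_eq_mul]
    linear_combination h - a i * a j * Real.mul_self_sqrt hkpos.le

/-- If all eigenvalues of a graph with an edge are at least `-t`, then `1 ≤ t`. -/
theorem Adj.one_le_of_neg_le_spectrum [DecidableEq V] {Γ : SimpleGraph V}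
    [DecidableRel Γ.Adj] {u v : V} (huv : Γ.Adj u v) {t : ℝ}
    (h : ∀ x ∈ spectrum ℝ (Γ.adjMatrix ℝ), -t ≤ x) : 1 ≤ t := by
  have hH : (Γ.adjMatrix ℝ).IsHermitian := by
    rw [Matrix.IsHermitian, conjTranspose_eq_transpose_of_trivial, transpose_adjMatrix]
  have h := (hH.posSemidef_sub_smul_one h).dotProduct_mulVec_nonneg
    (Pi.single u 1 - Pi.single v 1)
  simp [mulVec_sub, sub_dotProduct, dotProduct_sub, adjMatrix_apply, huv,
    huv.symm, huv.ne, huv.ne'] at h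
  linarith

/-- Pairing the eigenvalue equation `A β = s β` with the all-ones vector. -/
theorem sum_degree_mul_eq_of_adjMatrix_mulVec_eq_smul {s : ℝ} {β : V → ℝ}
    (hβ : Γ.adjMatrix ℝ *ᵥ β = s • β) : ∑ i, ((Γ.degree i : ℝ) - s) * β i = 0 := by
  classical
  have h1 : ∑ i, (Γ.adjMatrix ℝ *ᵥ β) i = ∑ i, (Γ.degree i : ℝ) * β i := by
    simp only [mulVec, dotProduct]
    rw [Finset.sum_comm]
    refine Finset.sum_congr rfl fun j _ => ?_
    rw [← Finset.sum_mul]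
    congr 1
    simp [adjMatrix_apply, Γ.adj_comm _ j, ← card_neighborFinset_eq_degree,
      neighborFinset_eq_filter]
  simp only [sub_mul, Finset.sum_sub_distrib, ← h1, hβ]
  simp

theorem minDegree_lt_of_adjMatrix_mulVec_eq_smul
    (hnonreg : ¬ ∃ k, Γ.IsRegularOfDegree k) {s : ℝ} {β : V → ℝ} (hpos : ∀ i, 0 < β i)
    (hβ : Γ.adjMatrix ℝ *ᵥ β = s • β) : (Γ.minDegree : ℝ) < s := by
  by_contra! h
  have hd : ∀ i, s ≤ Γ.degree i := fun i => h.trans (by exact_mod_cast Γ.minDegree_le_degree i)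
  have h0 := Γ.sum_degree_mul_eq_of_adjMatrix_mulVec_eq_smul hβ
  rw [Finset.sum_eq_zero_iff_of_nonneg
    fun i _ => mul_nonneg (sub_nonneg.mpr (hd i)) (hpos i).le] at h0
  refine hnonreg ⟨Γ.minDegree, fun i => le_antisymm ?_ (Γ.minDegree_le_degree i)⟩
  have hi := (mul_eq_zero.mp (h0 i (Finset.mem_univ i))).resolve_right (hpos i).ne'
  exact_mod_cast (sub_eq_zero.mp hi).trans_le h

theorem lt_maxDegree_of_adjMatrix_mulVec_eq_smul
    (hnonreg : ¬ ∃ k, Γ.IsRegularOfDegree k) {s : ℝ} {β : V → ℝ} (hpos : ∀ i, 0 < β i)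
    (hβ : Γ.adjMatrix ℝ *ᵥ β = s • β) : s < (Γ.maxDegree : ℝ) := by
  by_contra! h
  have hd : ∀ i, (Γ.degree i : ℝ) ≤ s :=
    fun i => le_trans (by exact_mod_cast Γ.degree_le_maxDegree i) h
  have h0 := Γ.sum_degree_mul_eq_of_adjMatrix_mulVec_eq_smul hβ
  rw [Finset.sum_eq_zero_iff_of_nonpos
    fun i _ => mul_nonpos_of_nonpos_of_nonneg (sub_nonpos.mpr (hd i)) (hpos i).le] at h0
  refine hnonreg ⟨Γ.maxDegree, fun i => le_antisymm (Γ.degree_le_maxDegree i) ?_⟩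
  have hi := (mul_eq_zero.mp (h0 i (Finset.mem_univ i))).resolve_right (hpos i).ne'
  exact_mod_cast h.trans_eq (sub_eq_zero.mp hi).symm

theorem exists_natCast_eq_adjMatrix_mul_self (i j : V) :
    ∃ m : ℕ, (Γ.adjMatrix ℝ * Γ.adjMatrix ℝ) i j = m := by
  classical
  exact ⟨_, by rw [adjMatrix_mul_apply]; simp only [adjMatrix_apply]; rw [Finset.sum_boole]⟩

/-- At a vertex `i` where the eigenvector `β` is minimal, `s² + 1 - n` is a sum of nonnegative
contributions of the other vertices. If `n = s² + 1`, then no neighbour of `i` has a common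
neighbour with `i`, and `β` is `1` at `i` and at all other vertices not adjacent to `i`. -/
theorem card_le_of_sq_adjMatrix_eq [DecidableEq V] {s t : ℝ} {β : V → ℝ} (hpos : ∀ i, 0 < β i)
    (hβ : Γ.adjMatrix ℝ *ᵥ β = s • β)
    (hsq : ∀ i j, (Γ.adjMatrix ℝ * Γ.adjMatrix ℝ) i j =
      (1 - t) * Γ.adjMatrix ℝ i j + t * (1 : Matrix V V ℝ) i j + β i * β j)
    {i : V} (hi : ∀ j, β i ≤ β j) :
    (Fintype.card V : ℝ) ≤ s ^ 2 + 1 ∧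
      ((Fintype.card V : ℝ) = s ^ 2 + 1 →
        (∀ j, Γ.Adj i j → β i * β j = t - 1) ∧
        ∀ j, j ≠ i → ¬ Γ.Adj i j → β i = 1 ∧ β j = 1) := by
  set A := Γ.adjMatrix ℝ with hA
  set g : V → ℝ := fun j => (A * A) i j * β j - (1 - A i j) * β i with hg
  have hnonadj : ∀ j, j ≠ i → ¬ Γ.Adj i j →
      1 ≤ β i * β j ∧ g j = β i * β j * β j - β i := by
    intro j hj hadj
    have hc := hsq i j
    simp only [hA, adjMatrix_apply, hadj, if_false, Matrix.one_apply_ne hj.symm, mul_zero,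
      zero_add] at hc
    refine ⟨?_, by
      simp only [hg, hA, hc, adjMatrix_apply, hadj, if_false, sub_zero, one_mul]⟩
    obtain ⟨m, hm⟩ := Γ.exists_natCast_eq_adjMatrix_mul_self i j
    have hm0 : (0 : ℝ) < m := by rw [← hm, hc]; exact mul_pos (hpos i) (hpos j)
    rw [← hc, hm]
    exact_mod_cast hm0
  have hadjg : ∀ j, Γ.Adj i j → g j = (A * A) i j * β j := by
    intro j hj
    simp [hg, hA, adjMatrix_apply, hj]
  have hnonneg : ∀ j ∈ Finset.univ.erase i, 0 ≤ g j := by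
    intro j hj
    by_cases hadj : Γ.Adj i j
    · rw [hadjg j hadj]
      obtain ⟨m, hm⟩ := Γ.exists_natCast_eq_adjMatrix_mul_self i j
      rw [hA, hm]
      exact mul_nonneg (Nat.cast_nonneg _) (hpos j).le
    · obtain ⟨h1, h2⟩ := hnonadj j (Finset.ne_of_mem_erase hj) hadj
      rw [h2]
      nlinarith [hi j, hpos j]
  have hAA : ∑ j, (A * A) i j * β j = s ^ 2 * β i := by
    have h : (A * A) *ᵥ β = (s * s) • β := by
      rw [← mulVec_mulVec, hβ, mulVec_smul, hβ, smul_smul]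
    simpa [mulVec, dotProduct, sq] using congrFun h i
  have hrow : ∑ j, A i j = Γ.degree i := by
    simp [hA, adjMatrix_apply, ← card_neighborFinset_eq_degree, neighborFinset_eq_filter]
  have hsum : ∑ j ∈ Finset.univ.erase i, g j = (s ^ 2 + 1 - Fintype.card V) * β i := by
    rw [Finset.sum_erase_eq_sub (Finset.mem_univ i)]
    have h1 : ∑ j, g j = s ^ 2 * β i - (Fintype.card V - Γ.degree i) * β i := by
      simp only [hg, Finset.sum_sub_distrib, hAA, ← Finset.sum_mul, hrow]
      simp
    have h2 : g i = (Γ.degree i - 1) * β i := by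
      simp only [hg, hA, adjMatrix_mul_self_apply_self]
      simp [adjMatrix_apply]
      ring
    rw [h1, h2]
    ring
  refine ⟨?_, fun hn => ?_⟩
  · have h := Finset.sum_nonneg hnonneg
    rw [hsum] at h
    linarith [nonneg_of_mul_nonneg_left h (hpos i)]
  · rw [hn, sub_self, zero_mul, Finset.sum_eq_zero_iff_of_nonneg hnonneg] at hsum
    refine ⟨fun j hadj => ?_, fun j hj hadj => ?_⟩
    · have h := hsum j (by simpa using hadj.ne')
      rw [hadjg j hadj] at h
      have hc := (mul_eq_zero.mp h).resolve_right (hpos j).ne'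
      rw [hsq] at hc
      simp only [hA, adjMatrix_apply, hadj, if_true, Matrix.one_apply_ne hadj.ne] at hc
      linarith
    · obtain ⟨h1, h2⟩ := hnonadj j hj hadj
      have h := hsum j (by simpa using hj)
      rw [h2] at h
      have hji : β j ≤ β i := by nlinarith [hpos j]
      have hij : β i = β j := le_antisymm (hi j) hji
      have hj1 : β j = 1 := by
        rw [hij] at h h1
        have h3 : β j * β j = 1 := mul_left_cancel₀ (hpos j).ne' (by linarith)
        nlinarith [hpos j]
      exact ⟨hij.trans hj1, hj1⟩

/-- The bound `n ≤ s² + 1` is never attained by a nonregular graph. -/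
theorem card_ne_of_sq_adjMatrix_eq [DecidableEq V] [Nonempty V]
    (hnonreg : ¬ ∃ k, Γ.IsRegularOfDegree k) {s t : ℝ} (ht : 1 ≤ t) {β : V → ℝ}
    (hpos : ∀ i, 0 < β i) (hβ : Γ.adjMatrix ℝ *ᵥ β = s • β)
    (hsq : ∀ i j, (Γ.adjMatrix ℝ * Γ.adjMatrix ℝ) i j =
      (1 - t) * Γ.adjMatrix ℝ i j + t * (1 : Matrix V V ℝ) i j + β i * β j)
    (hdeg : ∀ i, (Γ.degree i : ℝ) = t + β i ^ 2) :
    (Fintype.card V : ℝ) ≠ s ^ 2 + 1 := by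
  intro hn
  obtain ⟨i, hi⟩ := Finite.exists_min β
  obtain ⟨hadj, hnon⟩ := (Γ.card_le_of_sq_adjMatrix_eq hpos hβ hsq hi).2 hn
  by_cases hall : ∃ j, j ≠ i ∧ ¬ Γ.Adj i j
  · obtain ⟨j, hji, hij⟩ := hall
    obtain ⟨hi1, hj1⟩ := hnon j hji hij
    obtain ⟨hadj', -⟩ := (Γ.card_le_of_sq_adjMatrix_eq hpos hβ hsq
      (fun k => by rw [hj1, ← hi1]; exact hi k : ∀ k, β j ≤ β k)).2 hn
    have ht2 : t - 1 ≠ 1 := by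
      intro ht2
      have hone : ∀ k, β k = 1 := by
        intro k
        by_cases hk : Γ.Adj i k
        · have := hadj k hk
          rw [hi1] at this
          linarith
        · by_cases hki : k = i
          · rw [hki, hi1]
          · exact (hnon k hki hk).2
      refine hnonreg ⟨Γ.degree i, fun k => ?_⟩
      have h := hdeg k
      rw [hone k, ← hone i, ← hdeg i] at h
      exact_mod_cast h
    have hsub : ∀ k, Γ.Adj j k → Γ.Adj i k := by
      intro k hk
      by_contra hik
      have hki : k ≠ i := by
        rintro rfl
        exact hij hk.symm
      have h := hadj' k hk
      rw [hj1, (hnon k hki hik).2] at h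
      exact ht2 (by linarith)
    have hc := hsq i j
    rw [adjMatrix_apply, if_neg hij, Matrix.one_apply_ne hji.symm, hi1, hj1,
      mul_adjMatrix_apply, Finset.sum_congr rfl (g := fun _ => (1 : ℝ)) fun k hk => by
        simp [adjMatrix_apply, hsub k (by simpa using hk)]] at hc
    have hd := hdeg j
    simp [hj1] at hc hd
    rw [hc] at hd
    norm_num at hd
    linarith
  · push Not at hall
    have hdi : Γ.degree i + 1 = Fintype.card V := by
      have h : Γ.neighborFinset i = Finset.univ.erase i := by
        ext k
        simpa using ⟨fun h => h.ne', hall k⟩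
      rw [← card_neighborFinset_eq_degree, h, Finset.card_erase_of_mem (Finset.mem_univ i),
        Finset.card_univ]
      exact Nat.sub_add_cancel Fintype.card_pos
    refine hnonreg ⟨Γ.degree i, fun k => ?_⟩
    have h1 := Γ.degree_lt_card_verts k
    have h2 : (Γ.degree i : ℝ) ≤ Γ.degree k := by
      rw [hdeg, hdeg]
      nlinarith [hi k, hpos i]
    have h3 : Γ.degree i ≤ Γ.degree k := by exact_mod_cast h2
    omega

/-- A star with at least one edge has a vertex of degree at most one. -/
theorem exists_degree_le_one_of_iso_star {Γ : SimpleGraph V} [DecidableRel Γ.Adj] {m : ℕ}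
    (hm : 0 < m) (e : Γ ≃g completeBipartiteGraph (Fin 1) (Fin m)) : ∃ v, Γ.degree v ≤ 1 := by
  refine ⟨e.symm (Sum.inr ⟨0, hm⟩), ?_⟩
  rw [← card_neighborFinset_eq_degree, Finset.card_le_one]
  have h : ∀ a, Γ.Adj (e.symm (Sum.inr ⟨0, hm⟩)) a → e a = Sum.inl 0 := by
    intro a ha
    have h := e.map_adj_iff.mpr ha
    rw [RelIso.apply_symm_apply] at h
    rcases ha' : e a with b | b
    · rw [Subsingleton.elim b 0]
    · simp [ha'] at h
  intro a ha b hb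
  rw [mem_neighborFinset] at ha hb
  exact e.injective ((h a ha).trans (h b hb).symm)

end SimpleGraph

end

/-- For an n-vertex graph in H(s,t): δ(Γ) < s < Δ(Γ), and n ≤ s² + 1 with equality
iff Γ is the star K_{1,n−1}. -/
theorem H_st_degree_and_vertex_bounds
    {V : Type} [Fintype V] [DecidableEq V] (Γ : SimpleGraph V) [DecidableRel Γ.Adj]
    (s t : ℝ)
    (hconn : Γ.Connected)
    (hnonreg : ¬ ∃ k, Γ.IsRegularOfDegree k)
    (hs : 1 < s) (ht : -t < 1)
    (hspec : spectrum ℝ (Γ.adjMatrix ℝ) = {s, 1, -t}) :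
    (Γ.minDegree : ℝ) < s ∧ s < (Γ.maxDegree : ℝ) ∧
    (Fintype.card V : ℝ) ≤ s ^ 2 + 1 ∧
    ((Fintype.card V : ℝ) = s ^ 2 + 1 ↔
      Nonempty (Γ ≃g completeBipartiteGraph (Fin 1) (Fin (Fintype.card V - 1)))) := by
  obtain ⟨β, hpos, hβ, hsq⟩ := hconn.exists_sq_adjMatrix_eq hs ht hspec
  have hne := hconn.nonempty
  have hntriv : Nontrivial V := by
    by_contra h
    rw [not_nontrivial_iff_subsingleton] at h
    obtain ⟨v⟩ := hne
    exact hnonreg ⟨Γ.degree v, fun w => by rw [Subsingleton.elim w v]⟩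
  obtain ⟨u, v, huv⟩ : ∃ u v, Γ.Adj u v := by
    obtain ⟨u⟩ := hne
    exact ⟨u, hconn.preconnected.exists_adj_of_nontrivial u⟩
  have ht1 : 1 ≤ t := huv.one_le_of_neg_le_spectrum (by
    rw [hspec]
    rintro x (rfl | rfl | (rfl : x = -t)) <;> linarith)
  have hdeg : ∀ i, (Γ.degree i : ℝ) = t + β i ^ 2 := by
    intro i
    have h := hsq i i
    rw [SimpleGraph.adjMatrix_mul_self_apply_self] at h
    simp [SimpleGraph.adjMatrix_apply] at h
    rw [h, sq]
  obtain ⟨i, hi⟩ := Finite.exists_min β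
  have hcard := Γ.card_ne_of_sq_adjMatrix_eq hnonreg ht1 hpos hβ hsq hdeg
  refine ⟨Γ.minDegree_lt_of_adjMatrix_mulVec_eq_smul hnonreg hpos hβ,
    Γ.lt_maxDegree_of_adjMatrix_mulVec_eq_smul hnonreg hpos hβ,
    (Γ.card_le_of_sq_adjMatrix_eq hpos hβ hsq hi).1, fun h => absurd h hcard, fun ⟨e⟩ => ?_⟩
  obtain ⟨w, hw⟩ := SimpleGraph.exists_degree_le_one_of_iso_star
    (Nat.sub_pos_of_lt Fintype.one_lt_card) e
  have hw' : (Γ.degree w : ℝ) ≤ 1 := by exact_mod_cast hw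
  rw [hdeg] at hw'
  nlinarith [hpos w]
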